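/- For δ > 0, interpreting cos√u via its entire power series cos√u = Σ_{r=0}^∞ (−1)^r u^r/(2r)! (an entire function of u), one has ∫_{−∞}^{∞} e^{−δu²} (Σ_{r=0}^∞ (−1)^r u^r/(2r)!) du = (π/√δ) Σ_{r=0}^∞ (1/(64δ))^r / ((1)_r Γ(2r + 1/2)). -/

import Mathlib

open Real

noncomputable def poch (a : ℝ) (r : ℕ) : ℝ := (ascPochhammer ℝ r).eval a

theorem gamma_add_half_mul_factorial (n : ℕ) :
    Real.Gamma (n + 1 / 2) * (n.factorial * 4 ^ n) = (2 * n).factorial * √π := by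
  have h := Real.Gamma_mul_Gamma_add_half ((n : ℝ) + 1 / 2)
  rw [show (n : ℝ) + 1 / 2 + 1 / 2 = n + 1 by ring, Real.Gamma_nat_eq_factorial,
    show 2 * ((n : ℝ) + 1 / 2) = (2 * n : ℕ) + 1 by push_cast; ring,
    Real.Gamma_nat_eq_factorial,
    show (1 : ℝ) - ((2 * n : ℕ) + 1) = -(2 * n : ℕ) by ring, Real.rpow_neg zero_le_two,
    Real.rpow_natCast, pow_mul] at h
  rw [← mul_assoc, h]
  norm_num
  field_simp

theorem integral_even_pow_mul_gaussian {δ : ℝ} (hδ : 0 < δ) (r : ℕ) :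
    ∫ u : ℝ, u ^ (2 * r) * Real.exp (-δ * u ^ 2) =
      Real.Gamma (r + 1 / 2) / (√δ * δ ^ r) := by
  have h := integral_rpow_mul_exp_neg_mul_rpow (p := 2) (q := (2 * r : ℕ)) two_pos
    (lt_of_lt_of_le (by norm_num) (Nat.cast_nonneg _)) hδ
  simp only [Real.rpow_natCast, Real.rpow_two] at h
  have habs := integral_comp_abs (f := fun u : ℝ => u ^ (2 * r) * Real.exp (-δ * u ^ 2))
  simp only [pow_mul, sq_abs] at habs h ⊢
  rw [habs, h, show (((2 * r : ℕ) : ℝ) + 1) / 2 = r + 1 / 2 by push_cast; ring,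
    show -(((2 * r : ℕ) : ℝ) + 1) / 2 = -(1 / 2 + r) by push_cast; ring,
    Real.rpow_neg hδ.le, Real.rpow_add hδ, Real.rpow_natCast, ← Real.sqrt_eq_rpow]
  field_simp

theorem integral_odd_pow_mul_gaussian (δ : ℝ) {n : ℕ} (hn : Odd n) :
    ∫ u : ℝ, u ^ n * Real.exp (-δ * u ^ 2) = 0 := by
  have h := MeasureTheory.integral_neg_eq_self
    (fun u : ℝ => u ^ n * Real.exp (-δ * u ^ 2)) MeasureTheory.volume
  simp only [hn.neg_pow, neg_sq, neg_mul, MeasureTheory.integral_neg] at h ⊢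
  linarith

theorem integrable_gaussian_mul_exp_abs {δ : ℝ} (hδ : 0 < δ) :
    MeasureTheory.Integrable (fun u : ℝ => Real.exp (-δ * u ^ 2) * Real.exp |u|) := by
  refine ((integrable_exp_neg_mul_sq (half_pos hδ)).const_mul
    (Real.exp (1 / (2 * δ)))).mono' (by fun_prop) (.of_forall fun u => ?_)
  rw [Real.norm_of_nonneg (by positivity), ← Real.exp_add, ← Real.exp_add, Real.exp_le_exp]
  have h : 1 / (2 * δ) + -(δ / 2) * u ^ 2 - (-δ * u ^ 2 + |u|)
      = (δ * |u| - 1) ^ 2 / (2 * δ) := by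
    rw [← sq_abs u]
    field_simp
    ring
  have : 0 ≤ (δ * |u| - 1) ^ 2 / (2 * δ) := by positivity
  linarith

theorem hasSum_exp_series (x : ℝ) :
    HasSum (fun r : ℕ => x ^ r / (r.factorial : ℝ)) (Real.exp x) := by
  rw [Real.exp_eq_exp_ℝ]
  exact NormedSpace.expSeries_div_hasSum_exp x

theorem norm_cos_sqrt_term_le (u : ℝ) (r : ℕ) :
    ‖(-1) ^ r * u ^ r / (Nat.factorial (2 * r) : ℝ)‖ ≤ |u| ^ r / (r.factorial : ℝ) := by
  simp only [norm_div, norm_mul, norm_pow, norm_neg, norm_one, one_pow, one_mul,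
    Real.norm_eq_abs, Nat.abs_cast]
  gcongr
  omega

theorem hasSum_integral_gaussian_mul_cos_sqrt {δ : ℝ} (hδ : 0 < δ) :
    HasSum (fun r : ℕ => ∫ u : ℝ, Real.exp (-δ * u ^ 2) *
        ((-1) ^ r * u ^ r / (Nat.factorial (2 * r) : ℝ)))
      (∫ u : ℝ, Real.exp (-δ * u ^ 2) *
        ∑' r : ℕ, (-1) ^ r * u ^ r / (Nat.factorial (2 * r) : ℝ)) := by
  have hexp (u : ℝ) := (hasSum_exp_series |u|).mul_left (Real.exp (-δ * u ^ 2))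
  refine MeasureTheory.hasSum_integral_of_dominated_convergence
    (fun r u => Real.exp (-δ * u ^ 2) * (|u| ^ r / (r.factorial : ℝ)))
    (fun r => by fun_prop) (fun r => .of_forall fun u => ?_)
    (.of_forall fun u => (hexp u).summable) ?_ (.of_forall fun u => ?_)
  · rw [norm_mul, Real.norm_of_nonneg (Real.exp_pos _).le]
    gcongr
    exact norm_cos_sqrt_term_le u r
  · simpa only [(hexp _).tsum_eq] using integrable_gaussian_mul_exp_abs hδ
  · exact (Summable.of_norm_bounded (hasSum_exp_series |u|).summable
      (norm_cos_sqrt_term_le u)).hasSum.mul_left _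

theorem integral_gaussian_mul_cos_sqrt_term (δ : ℝ) (r : ℕ) :
    ∫ u : ℝ, Real.exp (-δ * u ^ 2) * ((-1) ^ r * u ^ r / (Nat.factorial (2 * r) : ℝ)) =
      (-1) ^ r / (Nat.factorial (2 * r) : ℝ) * ∫ u : ℝ, u ^ r * Real.exp (-δ * u ^ 2) := by
  rw [← MeasureTheory.integral_const_mul]
  congr 1 with u
  ring

theorem integral_gaussian_mul_cos_sqrt_even_term {δ : ℝ} (hδ : 0 < δ) (r : ℕ) :
    ∫ u : ℝ, Real.exp (-δ * u ^ 2) *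
        ((-1) ^ (2 * r) * u ^ (2 * r) / (Nat.factorial (2 * (2 * r)) : ℝ)) =
      π / √δ * ((1 / (64 * δ)) ^ r / (poch 1 r * Real.Gamma (2 * r + 1 / 2))) := by
  rw [integral_gaussian_mul_cos_sqrt_term, integral_even_pow_mul_gaussian hδ, poch,
    ascPochhammer_eval_one, (even_two_mul r).neg_one_pow]
  have h₁ := gamma_add_half_mul_factorial r
  have h₂ := gamma_add_half_mul_factorial (2 * r)
  push_cast at h₂
  have hΓ : 0 < Real.Gamma (2 * (r : ℝ) + 1 / 2) := Real.Gamma_pos_of_pos (by positivity)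
  have hπ : √π ^ 2 = π := Real.sq_sqrt Real.pi_pos.le
  have hs : 0 < √π := Real.sqrt_pos.2 Real.pi_pos
  have hd : 0 < √δ := Real.sqrt_pos.2 hδ
  rw [← eq_div_iff (by positivity)] at h₁
  rw [← div_eq_iff hs.ne'] at h₂
  rw [h₁, ← h₂, div_pow, mul_pow, show (64 : ℝ) ^ r = 4 ^ r * 4 ^ (2 * r) by
    rw [pow_mul, ← mul_pow]; norm_num, one_pow]
  generalize Real.Gamma (2 * (r : ℝ) + 1 / 2) = G at *
  field_simp
  exact hπ

theorem gaussian_cos_sqrt (δ : ℝ) (hδ : 0 < δ) :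
    ∫ u : ℝ, Real.exp (-δ * u ^ 2) *
        ∑' r : ℕ, (-1) ^ r * u ^ r / (Nat.factorial (2 * r) : ℝ) =
      Real.pi / Real.sqrt δ *
        ∑' r : ℕ, (1 / (64 * δ)) ^ r /
          (poch 1 r * Real.Gamma (2 * r + 1 / 2)) := by
  rw [← tsum_mul_left, ← (hasSum_integral_gaussian_mul_cos_sqrt hδ).tsum_eq]
  simp_rw [← integral_gaussian_mul_cos_sqrt_even_term hδ]
  refine ((mul_right_injective₀ (two_ne_zero' ℕ)).tsum_eq fun n hn => ?_).symm
  by_contra h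
  have hodd : Odd n := by
    rw [← Nat.not_even_iff_odd, even_iff_exists_two_mul]
    exact fun ⟨k, hk⟩ => h ⟨k, hk.symm⟩
  exact hn ((integral_gaussian_mul_cos_sqrt_term δ n).trans
    (by rw [integral_odd_pow_mul_gaussian δ hodd, mul_zero]))
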